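/- Let ν > η > 0 and μ := √(ν² − η²), and let ψ : (μ, ∞) → ℝ be three times continuously differentiable with ψ'(x) > 0 for all x > μ, satisfying V_ψ(x) = 1 − (ν² − 1/4)/x² + 2(1 − η)/(x² − μ²) − 3x²/(x² − μ²)² for all x > μ, and satisfying the asymptotics ψ(x) − (x − (π/4)(2ν − 1) + (4ν² + 3 + 8η)/(8x)) = O(x⁻³) as x → +∞. Then ψlo_{ν,η}(x) < ψ(x) for every x > x@_{μ,η}, where x@_{μ,η} is the greatest positive real root of the polynomial r_{μ,η}. -/

import Mathlib

/-- The potential `V_f` associated with a function `f` via Liouville's transformation. -/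
noncomputable def potential (f : ℝ → ℝ) (x : ℝ) : ℝ :=
  (deriv f x) ^ 2 + (1 / 2) * (deriv (deriv (deriv f)) x / deriv f x)
    - (3 / 4) * (deriv (deriv f) x / deriv f x) ^ 2

/-- The lower bound for the phase of ultraspherical Bessel derivatives: for `μ = √(ν² − η²)`,
`ψlo_{ν,η}(x) := √(x² − μ²) − (η²/(2μ) + μ)·arccos(μ/x) + η/√(x² − μ²)
  + (π/4)(η²/μ + 2(μ − ν) + 1)`. -/
noncomputable def psiLo (ν η x : ℝ) : ℝ :=
  Real.sqrt (x ^ 2 - Real.sqrt (ν ^ 2 - η ^ 2) ^ 2)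
    - (η ^ 2 / (2 * Real.sqrt (ν ^ 2 - η ^ 2)) + Real.sqrt (ν ^ 2 - η ^ 2))
      * Real.arccos (Real.sqrt (ν ^ 2 - η ^ 2) / x)
    + η / Real.sqrt (x ^ 2 - Real.sqrt (ν ^ 2 - η ^ 2) ^ 2)
    + (Real.pi / 4) * (η ^ 2 / Real.sqrt (ν ^ 2 - η ^ 2)
      + 2 * (Real.sqrt (ν ^ 2 - η ^ 2) - ν) + 1)

/-- The polynomial `r_{μ,η}(x)` from the paper. -/
noncomputable def rPoly (μ η x : ℝ) : ℝ :=
  12 * x ^ 14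
  + x ^ 12 * (-44 * μ ^ 2 + 4 * η * (η ^ 3 + 4 * η ^ 2 - 5 * η - 18))
  + x ^ 10 * (40 * μ ^ 4 + 8 * η * (-3 * η ^ 3 - 10 * η ^ 2 + 6 * η + 5) * μ ^ 2
      - η ^ 2 * (η + 2) ^ 2 * (4 * η ^ 2 + 8 * η - 3))
  + x ^ 8 * (40 * μ ^ 6 + 4 * η * (15 * η ^ 3 + 40 * η ^ 2 + 2 * η + 70) * μ ^ 4
      + η ^ 2 * (20 * η ^ 4 + 96 * η ^ 3 + 147 * η ^ 2 + 96 * η + 52) * μ ^ 2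
      + η ^ 4 * (η + 2) ^ 4)
  + x ^ 6 * (-100 * μ ^ 8 - 8 * η * (10 * η ^ 3 + 20 * η ^ 2 + 14 * η + 45) * μ ^ 6
      - η ^ 2 * (40 * η ^ 4 + 144 * η ^ 3 + 171 * η ^ 2 + 116 * η + 80) * μ ^ 4
      - 4 * η ^ 5 * (η + 2) ^ 3 * μ ^ 2)
  + x ^ 4 * (68 * μ ^ 10 + 4 * η * (15 * η ^ 3 + 20 * η ^ 2 + 27 * η + 20) * μ ^ 8
      + η ^ 2 * (40 * η ^ 4 + 96 * η ^ 3 + 81 * η ^ 2 + 24 * η + 16) * μ ^ 6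
      + 6 * η ^ 6 * (η + 2) ^ 2 * μ ^ 4)
  + x ^ 2 * (-16 * μ ^ 12 - 8 * η * (3 * η ^ 3 + 2 * η ^ 2 + 4 * η - 4) * μ ^ 10
      - 4 * η ^ 3 * (5 * η ^ 3 + 6 * η ^ 2 + 3 * η - 4) * μ ^ 8
      - 4 * η ^ 7 * (η + 2) * μ ^ 6)
  + (4 * η ^ 4 * μ ^ 12 + 4 * η ^ 6 * μ ^ 10 + η ^ 8 * μ ^ 8)

open Filter Topology

/-- The first derivative of `sin A / √A'`, where `p = A'` and `q = A''`. -/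
theorem hasDerivAt_sin_div_sqrt {A p : ℝ → ℝ} {q x : ℝ} (c : ℝ) (hp : 0 < p x)
    (hA : HasDerivAt A (p x) x) (hpq : HasDerivAt p q x) :
    HasDerivAt (fun y => Real.sin (A y - c) / √(p y))
      (Real.cos (A x - c) * √(p x) - Real.sin (A x - c) * q / (2 * p x * √(p x))) x := by
  have hs : 0 < √(p x) := Real.sqrt_pos.2 hp
  have hsq : √(p x) ^ 2 = p x := Real.sq_sqrt hp.le
  refine (((hA.sub_const c).sin).div (hpq.sqrt hp.ne') hs.ne').congr_deriv ?_
  set s := √(p x)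
  rw [← hsq]
  field_simp

/-- The function `sin A / √A'` solves `y'' + V_A y = 0`. -/
theorem hasDerivAt_deriv_sin_div_sqrt {A p q : ℝ → ℝ} {r x : ℝ} (c : ℝ) (hp : 0 < p x)
    (hA : HasDerivAt A (p x) x) (hpq : HasDerivAt p (q x) x) (hqr : HasDerivAt q r x) :
    HasDerivAt
      (fun y => Real.cos (A y - c) * √(p y) - Real.sin (A y - c) * q y / (2 * p y * √(p y)))
      (-(p x ^ 2 + 1 / 2 * (r / p x) - 3 / 4 * (q x / p x) ^ 2)
        * (Real.sin (A x - c) / √(p x))) x := by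
  have hs : 0 < √(p x) := Real.sqrt_pos.2 hp
  have hsq : √(p x) ^ 2 = p x := Real.sq_sqrt hp.le
  have hne : 2 * p x * √(p x) ≠ 0 := by positivity
  have hsqrt := hpq.sqrt hp.ne'
  refine (((hA.sub_const c).cos.mul hsqrt).sub
    (((hA.sub_const c).sin.mul hqr).div ((hpq.const_mul 2).mul hsqrt) hne)).congr_deriv ?_
  simp only [Pi.mul_apply]
  set s := √(p x)
  rw [← hsq]
  field_simp
  ring

/-- Sturm comparison for phases: where the potential of `f` exceeds that of `g`, the phase `f`
grows by more than `π` while `g` grows by `π`. -/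
theorem phase_add_pi_lt_of_potential_lt {f f₁ f₂ f₃ g g₁ g₂ g₃ : ℝ → ℝ} {a b : ℝ} (hab : a < b)
    (hf : ∀ x ∈ Set.Icc a b, HasDerivAt f (f₁ x) x)
    (hf₁ : ∀ x ∈ Set.Icc a b, HasDerivAt f₁ (f₂ x) x)
    (hf₂ : ∀ x ∈ Set.Icc a b, HasDerivAt f₂ (f₃ x) x)
    (hg : ∀ x ∈ Set.Icc a b, HasDerivAt g (g₁ x) x)
    (hg₁ : ∀ x ∈ Set.Icc a b, HasDerivAt g₁ (g₂ x) x)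
    (hg₂ : ∀ x ∈ Set.Icc a b, HasDerivAt g₂ (g₃ x) x)
    (hf₁pos : ∀ x ∈ Set.Icc a b, 0 < f₁ x) (hg₁pos : ∀ x ∈ Set.Icc a b, 0 < g₁ x)
    (hV : ∀ x ∈ Set.Icc a b,
      g₁ x ^ 2 + 1 / 2 * (g₃ x / g₁ x) - 3 / 4 * (g₂ x / g₁ x) ^ 2
        < f₁ x ^ 2 + 1 / 2 * (f₃ x / f₁ x) - 3 / 4 * (f₂ x / f₁ x) ^ 2)
    (hgab : g b = g a + Real.pi) : f a + Real.pi < f b := by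
  by_contra! hfb
  have ha : a ∈ Set.Icc a b := Set.left_mem_Icc.2 hab.le
  have hb : b ∈ Set.Icc a b := Set.right_mem_Icc.2 hab.le
  have strictMono_of : ∀ {h h₁ : ℝ → ℝ}, (∀ x ∈ Set.Icc a b, HasDerivAt h (h₁ x) x) →
      (∀ x ∈ Set.Ioo a b, 0 < h₁ x) → StrictMonoOn h (Set.Icc a b) := by
    intro h h₁ hh hpos
    refine strictMonoOn_of_deriv_pos (convex_Icc a b)
      (fun x hx => (hh x hx).continuousAt.continuousWithinAt) fun x hx => ?_
    rw [interior_Icc] at hx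
    rw [(hh x (Set.Ioo_subset_Icc_self hx)).deriv]
    exact hpos x hx
  have hfmono := strictMono_of hf fun x hx => hf₁pos x (Set.Ioo_subset_Icc_self hx)
  have hgmono := strictMono_of hg fun x hx => hg₁pos x (Set.Ioo_subset_Icc_self hx)
  let y : ℝ → ℝ := fun x => Real.sin (g x - g a) / √(g₁ x)
  let z : ℝ → ℝ := fun x => Real.sin (f x - f a) / √(f₁ x)
  let y' : ℝ → ℝ := fun x =>
    Real.cos (g x - g a) * √(g₁ x) - Real.sin (g x - g a) * g₂ x / (2 * g₁ x * √(g₁ x))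
  let z' : ℝ → ℝ := fun x =>
    Real.cos (f x - f a) * √(f₁ x) - Real.sin (f x - f a) * f₂ x / (2 * f₁ x * √(f₁ x))
  have hW := strictMono_of (h := fun x => y' x * z x - y x * z' x)
    (fun x hx =>
      ((hasDerivAt_deriv_sin_div_sqrt (g a) (hg₁pos x hx) (hg x hx) (hg₁ x hx) (hg₂ x hx)).mul
        (hasDerivAt_sin_div_sqrt (f a) (hf₁pos x hx) (hf x hx) (hf₁ x hx))).sub
      ((hasDerivAt_sin_div_sqrt (g a) (hg₁pos x hx) (hg x hx) (hg₁ x hx)).mul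
        (hasDerivAt_deriv_sin_div_sqrt (f a) (hf₁pos x hx) (hf x hx) (hf₁ x hx) (hf₂ x hx))))
    (by
      intro x hx
      have hx' := Set.Ioo_subset_Icc_self hx
      have hfa := hfmono ha hx' hx.1
      have hfb' := hfmono hx' hb hx.2
      have hga := hgmono ha hx' hx.1
      have hgb := hgmono hx' hb hx.2
      have hz : 0 < z x := div_pos (Real.sin_pos_of_pos_of_lt_pi (by linarith) (by linarith))
        (Real.sqrt_pos.2 (hf₁pos x hx'))
      have hy : 0 < y x := div_pos (Real.sin_pos_of_pos_of_lt_pi (by linarith) (by linarith))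
        (Real.sqrt_pos.2 (hg₁pos x hx'))
      have := mul_pos (sub_pos.2 (hV x hx')) (mul_pos hy hz)
      simp only [y, z] at this ⊢
      linear_combination this)
  have hlt := hW ha hb hab
  have hfab := hfmono ha hb hab
  have hgb : g b - g a = Real.pi := by linarith
  have hzb : 0 ≤ z b := div_nonneg
    (Real.sin_nonneg_of_nonneg_of_le_pi (by linarith) (by linarith)) (Real.sqrt_nonneg _)
  have hnonneg := mul_nonneg (Real.sqrt_nonneg (g₁ b)) hzb
  simp [y, y', z', hgb] at hlt
  simp [z] at hlt hnonneg
  linarith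

/-- A phase with the larger potential lies below a phase to which it is asymptotic. -/
theorem phase_lt_of_potential_lt {f f₁ f₂ f₃ g g₁ g₂ g₃ : ℝ → ℝ} {a : ℝ}
    (hf : ∀ x, a < x → HasDerivAt f (f₁ x) x)
    (hf₁ : ∀ x, a < x → HasDerivAt f₁ (f₂ x) x)
    (hf₂ : ∀ x, a < x → HasDerivAt f₂ (f₃ x) x)
    (hg : ∀ x, a < x → HasDerivAt g (g₁ x) x)
    (hg₁ : ∀ x, a < x → HasDerivAt g₁ (g₂ x) x)
    (hg₂ : ∀ x, a < x → HasDerivAt g₂ (g₃ x) x)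
    (hf₁pos : ∀ x, a < x → 0 < f₁ x) (hg₁pos : ∀ x, a < x → 0 < g₁ x)
    (hV : ∀ x, a < x →
      g₁ x ^ 2 + 1 / 2 * (g₃ x / g₁ x) - 3 / 4 * (g₂ x / g₁ x) ^ 2
        < f₁ x ^ 2 + 1 / 2 * (f₃ x / f₁ x) - 3 / 4 * (f₂ x / f₁ x) ^ 2)
    (hg_top : Tendsto g atTop atTop) (hfg : Tendsto (fun x => f x - g x) atTop (𝓝 0)) :
    ∀ x, a < x → f x < g x := by
  intro x₀ hx₀
  by_contra! hle
  have hgmono : StrictMonoOn g (Set.Ioi a) := by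
    refine strictMonoOn_of_deriv_pos (convex_Ioi a)
      (fun x hx => (hg x hx).continuousAt.continuousWithinAt) fun x hx => ?_
    rw [interior_Ioi] at hx
    rw [(hg x hx).deriv]
    exact hg₁pos x hx
  have step : ∀ x, a < x → ∃ y, a < y ∧ g y = g x + Real.pi ∧ f x + Real.pi < f y := by
    intro x hx
    obtain ⟨y, hy, hxy⟩ : ∃ y ∈ Set.Ici x, g y = g x + Real.pi :=
      isPreconnected_Ici.intermediate_value_Ici Set.self_mem_Ici
        (le_principal_iff.2 (Ici_mem_atTop x))
        (fun u hu => (hg u (hx.trans_le hu)).continuousAt.continuousWithinAt) hg_top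
        (Set.mem_Ici.2 (by linarith [Real.pi_pos]))
    have hne : x ≠ y := by
      rintro rfl
      linarith [Real.pi_pos]
    have hlt : x < y := lt_of_le_of_ne hy hne
    have hmem : ∀ u ∈ Set.Icc x y, a < u := fun u hu => hx.trans_le hu.1
    exact ⟨y, hx.trans hlt, hxy, phase_add_pi_lt_of_potential_lt hlt
      (fun u hu => hf u (hmem u hu)) (fun u hu => hf₁ u (hmem u hu))
      (fun u hu => hf₂ u (hmem u hu)) (fun u hu => hg u (hmem u hu))
      (fun u hu => hg₁ u (hmem u hu)) (fun u hu => hg₂ u (hmem u hu))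
      (fun u hu => hf₁pos u (hmem u hu)) (fun u hu => hg₁pos u (hmem u hu))
      (fun u hu => hV u (hmem u hu)) hxy⟩
  obtain ⟨x₁, hx₁, hgx₁, hfx₁⟩ := step x₀ hx₀
  have iter : ∀ n : ℕ, ∃ y, a < y ∧ g y = g x₁ + n * Real.pi ∧ f x₁ + n * Real.pi ≤ f y := by
    intro n
    induction n with
    | zero => exact ⟨x₁, hx₁, by simp, by simp⟩
    | succ n ih =>
      obtain ⟨y, hy, hgy, hfy⟩ := ih
      obtain ⟨w, hw, hgw, hfw⟩ := step y hy
      exact ⟨w, hw, by push_cast; linarith, by push_cast; linarith⟩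
  have hδ : 0 < f x₁ - g x₁ := by linarith
  obtain ⟨N, hN⟩ := eventually_atTop.1 (hfg.eventually_lt_const hδ)
  have hM : a < max N x₁ := hx₁.trans_le (le_max_right _ _)
  obtain ⟨n, hn⟩ := exists_nat_gt ((g (max N x₁) - g x₁) / Real.pi)
  rw [div_lt_iff₀ Real.pi_pos] at hn
  obtain ⟨y, hy, hgy, hfy⟩ := iter n
  have hlt : max N x₁ < y := (hgmono.lt_iff_lt hM hy).1 (by linarith)
  have := hN y ((le_max_left _ _).trans hlt.le)
  linarith

/-- The numerator of the derivative of `psiLo`, with `μ = √(ν² − η²)`. -/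
def psiLoNumerator (μ η x : ℝ) : ℝ :=
  2 * (x ^ 2 - μ ^ 2) ^ 2 - η ^ 2 * (x ^ 2 - μ ^ 2) - 2 * η * x ^ 2

/-- The derivative of `psiLoNumerator`. -/
def psiLoNumeratorDeriv (μ η x : ℝ) : ℝ :=
  8 * x * (x ^ 2 - μ ^ 2) - 2 * η ^ 2 * x - 4 * η * x

theorem hasDerivAt_psiLoNumerator (μ η x : ℝ) :
    HasDerivAt (psiLoNumerator μ η) (psiLoNumeratorDeriv μ η x) x := by
  have ht : HasDerivAt (fun y : ℝ => y ^ 2 - μ ^ 2) (2 * x) x := by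
    simpa using (hasDerivAt_pow 2 x).sub_const (μ ^ 2)
  refine ((((ht.pow 2).const_mul 2).sub (ht.const_mul (η ^ 2))).sub
    ((hasDerivAt_pow 2 x).const_mul (2 * η))).congr_deriv ?_
  simp only [psiLoNumeratorDeriv]
  push_cast
  ring

theorem hasDerivAt_psiLoNumeratorDeriv (μ η x : ℝ) :
    HasDerivAt (psiLoNumeratorDeriv μ η)
      (8 * (x ^ 2 - μ ^ 2) + 16 * x ^ 2 - 2 * η ^ 2 - 4 * η) x := by
  have ht : HasDerivAt (fun y : ℝ => y ^ 2 - μ ^ 2) (2 * x) x := by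
    simpa using (hasDerivAt_pow 2 x).sub_const (μ ^ 2)
  refine (((((hasDerivAt_id x).const_mul 8).mul ht).sub
    ((hasDerivAt_id x).const_mul (2 * η ^ 2))).sub
    ((hasDerivAt_id x).const_mul (4 * η))).congr_deriv ?_
  simp only [id]
  ring

/-- The logarithmic derivative of `1 / (2 x (x² − μ²)^{3/2})`. -/
noncomputable def weightLogDeriv (μ x : ℝ) : ℝ := -1 / x - 3 * x / (x ^ 2 - μ ^ 2)

theorem hasDerivAt_weight {μ x : ℝ} (hx : 0 < x) (ht : 0 < x ^ 2 - μ ^ 2) :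
    HasDerivAt (fun y => 1 / (2 * y * √(y ^ 2 - μ ^ 2) ^ 3))
      (1 / (2 * x * √(x ^ 2 - μ ^ 2) ^ 3) * weightLogDeriv μ x) x := by
  have hs : 0 < √(x ^ 2 - μ ^ 2) := Real.sqrt_pos.2 ht
  have hsq : √(x ^ 2 - μ ^ 2) ^ 2 = x ^ 2 - μ ^ 2 := Real.sq_sqrt ht.le
  have htd : HasDerivAt (fun y : ℝ => y ^ 2 - μ ^ 2) (2 * x) x := by
    simpa using (hasDerivAt_pow 2 x).sub_const (μ ^ 2)
  refine ((hasDerivAt_const x (1 : ℝ)).div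
    (((hasDerivAt_id x).const_mul 2).mul ((htd.sqrt ht.ne').pow 3))
    (by simp only [id, Pi.mul_apply, Pi.pow_apply]; positivity)).congr_deriv ?_
  simp only [id, Pi.mul_apply, Pi.pow_apply, weightLogDeriv]
  rw [← hsq]
  set s := √(x ^ 2 - μ ^ 2)
  rw [Real.sqrt_sq hs.le]
  field_simp
  push_cast
  ring

theorem hasDerivAt_weightLogDeriv {μ x : ℝ} (hx : 0 < x) (ht : 0 < x ^ 2 - μ ^ 2) :
    HasDerivAt (weightLogDeriv μ)
      (1 / x ^ 2 - 3 / (x ^ 2 - μ ^ 2) + 6 * x ^ 2 / (x ^ 2 - μ ^ 2) ^ 2) x := by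
  have htd : HasDerivAt (fun y : ℝ => y ^ 2 - μ ^ 2) (2 * x) x := by
    simpa using (hasDerivAt_pow 2 x).sub_const (μ ^ 2)
  refine (((hasDerivAt_const x (-1 : ℝ)).div (hasDerivAt_id x) hx.ne').sub
    (((hasDerivAt_id x).const_mul 3).div htd ht.ne')).congr_deriv ?_
  simp only [id]
  set t := x ^ 2 - μ ^ 2
  field_simp
  ring

theorem hasDerivAt_psiLo {ν η x : ℝ} (hμ : 0 < √(ν ^ 2 - η ^ 2)) (hx : √(ν ^ 2 - η ^ 2) < x) :
    HasDerivAt (psiLo ν η) (psiLoNumerator √(ν ^ 2 - η ^ 2) η x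
      * (1 / (2 * x * √(x ^ 2 - √(ν ^ 2 - η ^ 2) ^ 2) ^ 3))) x := by
  unfold psiLo
  set μ := √(ν ^ 2 - η ^ 2)
  have hx0 : 0 < x := hμ.trans hx
  have ht : 0 < x ^ 2 - μ ^ 2 := by nlinarith
  have hs : 0 < √(x ^ 2 - μ ^ 2) := Real.sqrt_pos.2 ht
  have hsq : √(x ^ 2 - μ ^ 2) ^ 2 = x ^ 2 - μ ^ 2 := Real.sq_sqrt ht.le
  have htd : HasDerivAt (fun y : ℝ => y ^ 2 - μ ^ 2) (2 * x) x := by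
    simpa using (hasDerivAt_pow 2 x).sub_const (μ ^ 2)
  have hsd := htd.sqrt ht.ne'
  have hq1 : μ / x < 1 := (div_lt_one hx0).2 hx
  have hq0 : 0 < μ / x := by positivity
  have hacos := (Real.hasDerivAt_arccos (by linarith : μ / x ≠ -1) hq1.ne).comp x
    ((hasDerivAt_const x μ).div (hasDerivAt_id x) hx0.ne')
  have hroot : √(1 - (μ / x) ^ 2) = √(x ^ 2 - μ ^ 2) / x := by
    rw [show 1 - (μ / x) ^ 2 = (x ^ 2 - μ ^ 2) / x ^ 2 by field_simp,
      Real.sqrt_div' _ (by positivity), Real.sqrt_sq hx0.le]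
  refine ((((hsd.sub (hacos.const_mul (η ^ 2 / (2 * μ) + μ))).add
    ((hasDerivAt_const x η).div hsd hs.ne')).add_const _)).congr_deriv ?_
  simp only [psiLoNumerator, hroot]
  have hx2 : x ^ 2 = √(x ^ 2 - μ ^ 2) ^ 2 + μ ^ 2 := by rw [hsq]; ring
  set s := √(x ^ 2 - μ ^ 2)
  rw [← hsq]
  field_simp
  rw [hx2]
  linear_combination (-2 * μ * η) * hx2

/-- `rPoly` is, up to a positive factor, the difference of the potentials of `psiLo` and of the
phase function, with all denominators cleared. -/
theorem rPoly_eq (μ η x : ℝ) :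
    rPoly μ η x = psiLoNumerator μ η x ^ 4
      + 2 * x ^ 2 * (x ^ 2 - μ ^ 2) ^ 3
        * (8 * (x ^ 2 - μ ^ 2) + 16 * x ^ 2 - 2 * η ^ 2 - 4 * η) * psiLoNumerator μ η x
      - 3 * x ^ 2 * (x ^ 2 - μ ^ 2) ^ 3 * psiLoNumeratorDeriv μ η x ^ 2
      + 2 * psiLoNumerator μ η x ^ 2 * ((x ^ 2 - μ ^ 2) ^ 3 - 3 * x ^ 2 * (x ^ 2 - μ ^ 2) ^ 2
        + 6 * x ^ 4 * (x ^ 2 - μ ^ 2))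
      + 2 * x * (x ^ 2 - μ ^ 2) ^ 2 * psiLoNumeratorDeriv μ η x * psiLoNumerator μ η x
        * (x ^ 2 - μ ^ 2 + 3 * x ^ 2)
      - (x ^ 2 - μ ^ 2) * psiLoNumerator μ η x ^ 2 * (x ^ 2 - μ ^ 2 + 3 * x ^ 2) ^ 2
      - psiLoNumerator μ η x ^ 2 * (x ^ 2 - μ ^ 2) * (4 * x ^ 2 * (x ^ 2 - μ ^ 2) ^ 2
        - (4 * (μ ^ 2 + η ^ 2) - 1) * (x ^ 2 - μ ^ 2) ^ 2
        + 8 * (1 - η) * x ^ 2 * (x ^ 2 - μ ^ 2) - 12 * x ^ 4) := by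
  simp only [rPoly, psiLoNumerator, psiLoNumeratorDeriv]
  ring

theorem tendsto_mul_sq_add_atTop {p : ℝ → ℝ} (hp : Tendsto p atTop atTop) (c : ℝ) :
    Tendsto (fun x => p x * x ^ 2 + c) atTop atTop :=
  tendsto_atTop_add_const_right _ _ (hp.atTop_mul_atTop₀ (tendsto_pow_atTop two_ne_zero))

theorem tendsto_rPoly_atTop (μ η : ℝ) : Tendsto (rPoly μ η) atTop atTop := by
  have h12 : Tendsto (fun x : ℝ => 12 * x ^ 2
      + (-44 * μ ^ 2 + 4 * η * (η ^ 3 + 4 * η ^ 2 - 5 * η - 18))) atTop atTop :=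
    tendsto_atTop_add_const_right _ _
      ((tendsto_pow_atTop two_ne_zero).const_mul_atTop (by norm_num))
  have h10 := tendsto_mul_sq_add_atTop h12
    (40 * μ ^ 4 + 8 * η * (-3 * η ^ 3 - 10 * η ^ 2 + 6 * η + 5) * μ ^ 2
      - η ^ 2 * (η + 2) ^ 2 * (4 * η ^ 2 + 8 * η - 3))
  have h8 := tendsto_mul_sq_add_atTop h10
    (40 * μ ^ 6 + 4 * η * (15 * η ^ 3 + 40 * η ^ 2 + 2 * η + 70) * μ ^ 4
      + η ^ 2 * (20 * η ^ 4 + 96 * η ^ 3 + 147 * η ^ 2 + 96 * η + 52) * μ ^ 2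
      + η ^ 4 * (η + 2) ^ 4)
  have h6 := tendsto_mul_sq_add_atTop h8
    (-100 * μ ^ 8 - 8 * η * (10 * η ^ 3 + 20 * η ^ 2 + 14 * η + 45) * μ ^ 6
      - η ^ 2 * (40 * η ^ 4 + 144 * η ^ 3 + 171 * η ^ 2 + 116 * η + 80) * μ ^ 4
      - 4 * η ^ 5 * (η + 2) ^ 3 * μ ^ 2)
  have h4 := tendsto_mul_sq_add_atTop h6
    (68 * μ ^ 10 + 4 * η * (15 * η ^ 3 + 20 * η ^ 2 + 27 * η + 20) * μ ^ 8
      + η ^ 2 * (40 * η ^ 4 + 96 * η ^ 3 + 81 * η ^ 2 + 24 * η + 16) * μ ^ 6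
      + 6 * η ^ 6 * (η + 2) ^ 2 * μ ^ 4)
  have h2 := tendsto_mul_sq_add_atTop h4
    (-16 * μ ^ 12 - 8 * η * (3 * η ^ 3 + 2 * η ^ 2 + 4 * η - 4) * μ ^ 10
      - 4 * η ^ 3 * (5 * η ^ 3 + 6 * η ^ 2 + 3 * η - 4) * μ ^ 8
      - 4 * η ^ 7 * (η + 2) * μ ^ 6)
  refine (tendsto_mul_sq_add_atTop h2
    (4 * η ^ 4 * μ ^ 12 + 4 * η ^ 6 * μ ^ 10 + η ^ 8 * μ ^ 8)).congr fun x => ?_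
  simp only [rPoly]
  ring

theorem tendsto_psiLoNumerator_atTop (μ η : ℝ) :
    Tendsto (psiLoNumerator μ η) atTop atTop := by
  have h2 : Tendsto (fun x : ℝ => 2 * x ^ 2 + (-4 * μ ^ 2 - η ^ 2 - 2 * η)) atTop atTop :=
    tendsto_atTop_add_const_right _ _
      ((tendsto_pow_atTop two_ne_zero).const_mul_atTop (by norm_num))
  refine (tendsto_mul_sq_add_atTop h2 (2 * μ ^ 4 + η ^ 2 * μ ^ 2)).congr fun x => ?_
  simp only [psiLoNumerator]
  ring

theorem exists_ge_eq_zero_of_nonpos {p : ℝ → ℝ} (hc : Continuous p)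
    (hp : Tendsto p atTop atTop) {x : ℝ} (hx : p x ≤ 0) : ∃ y, x ≤ y ∧ p y = 0 :=
  isPreconnected_Ici.intermediate_value_Ici Set.self_mem_Ici
    (le_principal_iff.2 (Ici_mem_atTop x)) hc.continuousOn hp hx

theorem tendsto_psiLo_sub (ν η : ℝ) (hμ : 0 < √(ν ^ 2 - η ^ 2)) :
    Tendsto (fun x => psiLo ν η x - (x - (Real.pi / 4) * (2 * ν - 1))) atTop (𝓝 0) := by
  unfold psiLo
  set μ := √(ν ^ 2 - η ^ 2)
  have hs : Tendsto (fun x : ℝ => √(x ^ 2 - μ ^ 2)) atTop atTop :=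
    Real.tendsto_sqrt_atTop.comp
      (tendsto_atTop_add_const_right _ (-μ ^ 2) (tendsto_pow_atTop two_ne_zero) |>.congr
        fun x => by ring)
  have hdiff : Tendsto (fun x : ℝ => √(x ^ 2 - μ ^ 2) - x) atTop (𝓝 0) := by
    have := (tendsto_const_nhds (x := -μ ^ 2)).div_atTop
      (hs.atTop_add_atTop tendsto_id)
    refine this.congr' ?_
    filter_upwards [eventually_gt_atTop μ] with x hx
    have hx0 : 0 < x := hμ.trans hx
    have ht : 0 < x ^ 2 - μ ^ 2 := by nlinarith
    have hpos : √(x ^ 2 - μ ^ 2) + x ≠ 0 := by positivity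
    simp only [id]
    rw [div_eq_iff hpos]
    linear_combination -Real.sq_sqrt ht.le
  have hacos : Tendsto (fun x : ℝ => Real.arccos (μ / x)) atTop (𝓝 (Real.pi / 2)) := by
    have := (Real.continuous_arccos.tendsto 0).comp
      ((tendsto_const_nhds (x := μ)).div_atTop tendsto_id)
    simpa [Function.comp_def] using this
  have hη : Tendsto (fun x : ℝ => η / √(x ^ 2 - μ ^ 2)) atTop (𝓝 0) :=
    tendsto_const_nhds.div_atTop hs
  have := ((hdiff.sub (hacos.const_mul (η ^ 2 / (2 * μ) + μ))).add hη).add_const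
    (Real.pi / 4 * (η ^ 2 / μ + 2 * (μ - ν) + 1) + Real.pi / 4 * (2 * ν - 1))
  convert this using 2
  · ring
  · field_simp
    ring

/-- Derivatives of a `C³` function on an open half-line, in pointwise form. -/
theorem ContDiffOn.hasDerivAt_Ioi_three {ψ : ℝ → ℝ} {a x : ℝ}
    (h : ContDiffOn ℝ 3 ψ (Set.Ioi a)) (hx : a < x) :
    HasDerivAt ψ (deriv ψ x) x ∧ HasDerivAt (deriv ψ) (deriv (deriv ψ) x) x ∧
      HasDerivAt (deriv (deriv ψ)) (deriv (deriv (deriv ψ)) x) x := by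
  have h₁ : ContDiffOn ℝ 2 (deriv ψ) (Set.Ioi a) := h.deriv_of_isOpen isOpen_Ioi (by norm_num)
  have h₂ : ContDiffOn ℝ 1 (deriv (deriv ψ)) (Set.Ioi a) :=
    h₁.deriv_of_isOpen isOpen_Ioi (by norm_num)
  have hmem : Set.Ioi a ∈ 𝓝 x := Ioi_mem_nhds hx
  exact ⟨((h.differentiableOn (by norm_num)).differentiableAt hmem).hasDerivAt,
    ((h₁.differentiableOn (by norm_num)).differentiableAt hmem).hasDerivAt,
    ((h₂.differentiableOn (by norm_num)).differentiableAt hmem).hasDerivAt⟩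

/-- Lower bound for the phase function of derivatives of ultraspherical Bessel functions:
any function `ψ` satisfying the defining properties of the phase function `ψ_{ν,η}` is
bounded below by `ψlo_{ν,η}` on `(x@_{μ,η}, ∞)`, where `x@_{μ,η}` is the greatest positive
real root of the polynomial `r_{μ,η}` and `μ = √(ν² − η²)`. -/
theorem ultraspherical_phase_lower_bound (ν η : ℝ) (hη : 0 < η) (hν : η < ν)
    (xAt : ℝ) (hxAt : 0 < xAt ∧ rPoly (Real.sqrt (ν ^ 2 - η ^ 2)) η xAt = 0 ∧
      ∀ y, 0 < y → rPoly (Real.sqrt (ν ^ 2 - η ^ 2)) η y = 0 → y ≤ xAt)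
    (ψ : ℝ → ℝ)
    (hψ : ContDiffOn ℝ 3 ψ (Set.Ioi (Real.sqrt (ν ^ 2 - η ^ 2))))
    (hψ' : ∀ x, Real.sqrt (ν ^ 2 - η ^ 2) < x → 0 < deriv ψ x)
    (hV : ∀ x, Real.sqrt (ν ^ 2 - η ^ 2) < x →
      potential ψ x = 1 - (ν ^ 2 - 1 / 4) / x ^ 2
        + 2 * (1 - η) / (x ^ 2 - Real.sqrt (ν ^ 2 - η ^ 2) ^ 2)
        - 3 * x ^ 2 / (x ^ 2 - Real.sqrt (ν ^ 2 - η ^ 2) ^ 2) ^ 2)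
    (hasymp : Asymptotics.IsBigO Filter.atTop
      (fun x : ℝ => ψ x - (x - (Real.pi / 4) * (2 * ν - 1)
        + (4 * ν ^ 2 + 3 + 8 * η) / (8 * x)))
      (fun x : ℝ => 1 / x ^ 3)) :
    ∀ x, xAt < x → psiLo ν η x < ψ x := by
  set μ := √(ν ^ 2 - η ^ 2) with hμdef
  have hμsq : μ ^ 2 = ν ^ 2 - η ^ 2 := Real.sq_sqrt (by nlinarith)
  have hμ : 0 < μ := Real.sqrt_pos.2 (by nlinarith)
  obtain ⟨-, -, hmax⟩ := hxAt
  have hr : ∀ x, 0 < x → rPoly μ η x ≤ 0 → x ≤ xAt := by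
    intro x hx hrx
    obtain ⟨y, hxy, hy⟩ := exists_ge_eq_zero_of_nonpos
      (by unfold rPoly; fun_prop) (tendsto_rPoly_atTop μ η) hrx
    exact hxy.trans (hmax y (hx.trans_le hxy) hy)
  have hP : ∀ x, μ ≤ x → psiLoNumerator μ η x ≤ 0 → x ≤ xAt := by
    intro x hx hPx
    obtain ⟨y, hxy, hy⟩ := exists_ge_eq_zero_of_nonpos
      (by unfold psiLoNumerator; fun_prop) (tendsto_psiLoNumerator_atTop μ η) hPx
    have hμy : μ ≤ y := hx.trans hxy
    have ht : 0 ≤ y ^ 2 - μ ^ 2 := by nlinarith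
    have hnonneg : 0 ≤ 3 * y ^ 2 * (y ^ 2 - μ ^ 2) ^ 3 * psiLoNumeratorDeriv μ η y ^ 2 := by
      positivity
    refine hxy.trans (hr y (hμ.trans_le hμy) ?_)
    rw [rPoly_eq, hy]
    linarith
  have hμxAt : μ ≤ xAt := hP μ le_rfl (by
    have : 0 < η * μ ^ 2 := by positivity
    simp only [psiLoNumerator]
    linarith)
  have hlim : Tendsto (fun x => ψ x - (x - (Real.pi / 4) * (2 * ν - 1))) atTop (𝓝 0) := by
    have hinv : Tendsto (fun x : ℝ => 1 / x ^ 3) atTop (𝓝 0) :=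
      tendsto_const_nhds.div_atTop (tendsto_pow_atTop three_ne_zero)
    have hk : Tendsto (fun x : ℝ => (4 * ν ^ 2 + 3 + 8 * η) / (8 * x)) atTop (𝓝 0) :=
      tendsto_const_nhds.div_atTop (tendsto_id.const_mul_atTop (by norm_num))
    simpa using ((hasymp.trans_tendsto hinv).add hk).congr fun x => by ring
  have hψtop : Tendsto ψ atTop atTop := by
    have := hlim.add_atTop (tendsto_atTop_add_const_right atTop
      (-((Real.pi / 4) * (2 * ν - 1))) tendsto_id)
    exact this.congr fun x => by simp only [id]; ring
  have hfg : Tendsto (fun x => psiLo ν η x - ψ x) atTop (𝓝 0) := by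
    have := (tendsto_psiLo_sub ν η hμ).sub hlim
    simpa using this
  have hd := fun x (hx : xAt < x) => hψ.hasDerivAt_Ioi_three (hμxAt.trans_lt hx)
  have hbase : ∀ x, xAt < x → 0 < x ∧ 0 < x ^ 2 - μ ^ 2 := fun x hx =>
    ⟨hμ.trans_le (hμxAt.trans hx.le), by nlinarith⟩
  have hPpos : ∀ x, xAt < x → 0 < psiLoNumerator μ η x := fun x hx => by
    by_contra! h
    exact hx.not_ge (hP x (hμxAt.trans hx.le) h)
  let w : ℝ → ℝ := fun x => 1 / (2 * x * √(x ^ 2 - μ ^ 2) ^ 3)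
  have hwpos : ∀ x, xAt < x → 0 < w x := fun x hx => by
    have := (hbase x hx).1
    have := Real.sqrt_pos.2 (hbase x hx).2
    positivity
  have hw : ∀ x, xAt < x → HasDerivAt w (w x * weightLogDeriv μ x) x := fun x hx =>
    hasDerivAt_weight (hbase x hx).1 (hbase x hx).2
  refine phase_lt_of_potential_lt
    (f₁ := fun x => psiLoNumerator μ η x * w x)
    (fun x hx => hasDerivAt_psiLo hμ (hμxAt.trans_lt hx))
    (fun x hx => (hasDerivAt_psiLoNumerator μ η x).mul (hw x hx))
    (fun x hx => ((hasDerivAt_psiLoNumeratorDeriv μ η x).mul (hw x hx)).add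
      ((hasDerivAt_psiLoNumerator μ η x).mul ((hw x hx).mul
        (hasDerivAt_weightLogDeriv (hbase x hx).1 (hbase x hx).2))))
    (fun x hx => (hd x hx).1) (fun x hx => (hd x hx).2.1) (fun x hx => (hd x hx).2.2)
    (fun x hx => mul_pos (hPpos x hx) (hwpos x hx))
    (fun x hx => hψ' x (hμxAt.trans_lt hx)) (fun x hx => ?_) hψtop hfg
  obtain ⟨hx0, ht⟩ := hbase x hx
  have hrpos : 0 < rPoly μ η x := by
    by_contra! h
    exact hx.not_ge (hr x hx0 h)
  have hVx := hV x (hμxAt.trans_lt hx)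
  unfold potential at hVx
  rw [hVx, ← sub_pos]
  have hp := hPpos x hx
  have hwx := hwpos x hx
  have hwsq : w x ^ 2 = 1 / (4 * x ^ 2 * (x ^ 2 - μ ^ 2) ^ 3) := by
    have hs := Real.sq_sqrt ht.le
    simp only [w]
    rw [div_pow, mul_pow, ← pow_mul, mul_comm 3 2, pow_mul, hs]
    ring
  have hν2 : ν ^ 2 = μ ^ 2 + η ^ 2 := by linarith
  refine lt_of_lt_of_eq (b := rPoly μ η x
    / (4 * x ^ 2 * (x ^ 2 - μ ^ 2) ^ 3 * psiLoNumerator μ η x ^ 2)) (by positivity) ?_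
  rw [rPoly_eq, mul_pow, hwsq, hν2]
  simp only [weightLogDeriv]
  clear_value w
  generalize psiLoNumerator μ η x = P at *
  generalize psiLoNumeratorDeriv μ η x = P₁ at *
  generalize w x = W at *
  generalize x ^ 2 - μ ^ 2 = t at *
  field_simp
  ring
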